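/- Fix t > 0, a compact interval [a,b] ⊂ ℝ with a < b, and a real p with 0 ≤ p < 1. Then the double integral ∫_a^b ∫_a^b [∫_0^t ∫_ℝ (G(r, x−z) − G(r, y−z))² dz dr]^{−(p+1)/2} dx dy is finite. -/

import Mathlib

open MeasureTheory Real

/-- The Green kernel (heat kernel) of the heat equation `∂ₜu = (1/2)Δu` on `ℝ`. -/
noncomputable def G (t x : ℝ) : ℝ :=
  if 0 < t then (1 / Real.sqrt (2 * Real.pi * t)) * Real.exp (-x ^ 2 / (2 * t)) else 0

lemma G_mul_G {r : ℝ} (hr : 0 < r) (x y z : ℝ) :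
    G r (x - z) * G r (y - z) =
      1 / (2 * π * r) * exp (-(x - y) ^ 2 / (4 * r)) *
        exp (-(1 / r) * (z - (x + y) / 2) ^ 2) := by
  have h : sqrt (2 * π * r) * sqrt (2 * π * r) = 2 * π * r := mul_self_sqrt (by positivity)
  simp only [G, hr, if_true]
  rw [mul_mul_mul_comm, ← exp_add, div_mul_div_comm, h, mul_one, mul_assoc (1 / (2 * π * r)),
    ← exp_add]
  congr 2
  field_simp
  ring

lemma integrable_G_mul_G {r : ℝ} (hr : 0 < r) (x y : ℝ) :
    Integrable fun z ↦ G r (x - z) * G r (y - z) := by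
  simp only [G_mul_G hr]
  exact ((integrable_exp_neg_mul_sq (one_div_pos.2 hr)).comp_sub_right ((x + y) / 2)).const_mul _

lemma integral_G_mul_G {r : ℝ} (hr : 0 < r) (x y : ℝ) :
    ∫ z, G r (x - z) * G r (y - z) =
      1 / (2 * sqrt (π * r)) * exp (-(x - y) ^ 2 / (4 * r)) := by
  simp only [G_mul_G hr]
  rw [integral_const_mul,
    integral_sub_right_eq_self (fun z ↦ exp (-(1 / r) * z ^ 2)) ((x + y) / 2), integral_gaussian,
    div_div_eq_mul_div, div_one]
  have h : sqrt (π * r) * sqrt (π * r) = π * r := mul_self_sqrt (by positivity)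
  have h0 : 0 < sqrt (π * r) := sqrt_pos.2 (by positivity)
  field_simp
  linarith

lemma integral_G_sub_G_sq {r : ℝ} (hr : 0 < r) (x y : ℝ) :
    ∫ z, (G r (x - z) - G r (y - z)) ^ 2 =
      1 / sqrt (π * r) * (1 - exp (-(x - y) ^ 2 / (4 * r))) := by
  have h : ∀ z, (G r (x - z) - G r (y - z)) ^ 2 =
      G r (x - z) * G r (x - z) + G r (y - z) * G r (y - z)
        - 2 * (G r (x - z) * G r (y - z)) := fun z ↦ by ring
  have hadd : Integrable fun z ↦ G r (x - z) * G r (x - z) + G r (y - z) * G r (y - z) :=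
    (integrable_G_mul_G hr x x).add (integrable_G_mul_G hr y y)
  simp only [h]
  rw [integral_sub hadd ((integrable_G_mul_G hr x y).const_mul 2),
    integral_add (integrable_G_mul_G hr x x) (integrable_G_mul_G hr y y), integral_const_mul,
    integral_G_mul_G hr, integral_G_mul_G hr, integral_G_mul_G hr]
  have h0 : 0 < sqrt (π * r) := sqrt_pos.2 (by positivity)
  simp
  field_simp
  ring

lemma one_sub_exp_neg_sq_div_nonneg {r : ℝ} (hr : 0 ≤ r) (d : ℝ) :
    0 ≤ 1 - exp (-d ^ 2 / (4 * r)) := by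
  rw [sub_nonneg, exp_le_one_iff, neg_div, neg_nonpos]
  positivity

lemma intervalIntegrable_inv_sqrt_mul_one_sub_exp {t : ℝ} (ht : 0 < t) (d : ℝ) :
    IntervalIntegrable (fun r ↦ 1 / sqrt (π * r) * (1 - exp (-d ^ 2 / (4 * r)))) volume 0 t := by
  have h : IntervalIntegrable (fun r : ℝ ↦ 1 / sqrt π * r ^ (-(1 / 2) : ℝ)) volume 0 t :=
    (intervalIntegral.intervalIntegrable_rpow' (by norm_num)).const_mul _
  refine h.mono_fun (by fun_prop) ?_
  rw [Set.uIoc_of_le ht.le]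
  filter_upwards [ae_restrict_mem measurableSet_Ioc] with r hr
  have h1 := one_sub_exp_neg_sq_div_nonneg hr.1.le d
  have h2 : 1 - exp (-d ^ 2 / (4 * r)) ≤ 1 := by linarith [exp_pos (-d ^ 2 / (4 * r))]
  have h3 : 1 / sqrt π * r ^ (-(1 / 2) : ℝ) = 1 / sqrt (π * r) := by
    rw [rpow_neg hr.1.le, ← sqrt_eq_rpow, sqrt_mul pi_pos.le]
    simp [mul_comm]
  rw [h3, norm_mul]
  refine mul_le_of_le_one_right (norm_nonneg _) ?_
  rwa [norm_of_nonneg h1]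

/-- The increments of the solution have variance at least of order `|x - y|`. -/
lemma exists_mul_abs_le_integral {t L : ℝ} (ht : 0 < t) (hL : 0 < L) :
    ∃ C > 0, ∀ x y : ℝ, |x - y| ≤ L →
      C * |x - y| ≤ ∫ r in (0 : ℝ)..t, ∫ z : ℝ, (G r (x - z) - G r (y - z)) ^ 2 := by
  set κ := t / L ^ 2 with hκ
  have hκ0 : 0 < κ := by positivity
  have hc : 0 < 1 - exp (-(1 / (4 * κ))) := by
    rw [sub_pos, exp_lt_one_iff, neg_lt_zero]
    positivity
  refine ⟨κ * (1 / sqrt (π * κ) * (1 - exp (-(1 / (4 * κ))))), by positivity, fun x y hxy ↦ ?_⟩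
  set d := x - y with hd
  have hI : ∫ r in (0 : ℝ)..t, ∫ z : ℝ, (G r (x - z) - G r (y - z)) ^ 2 =
      ∫ r in (0 : ℝ)..t, 1 / sqrt (π * r) * (1 - exp (-d ^ 2 / (4 * r))) := by
    refine intervalIntegral.integral_congr_ae (Filter.Eventually.of_forall fun r hr ↦ ?_)
    rw [Set.uIoc_of_le ht.le] at hr
    exact integral_G_sub_G_sq hr.1 x y
  have hnn : ∀ r, 0 ≤ r → 0 ≤ 1 / sqrt (π * r) * (1 - exp (-d ^ 2 / (4 * r))) := fun r hr ↦
    mul_nonneg (by positivity) (one_sub_exp_neg_sq_div_nonneg hr d)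
  rw [hI]
  rcases eq_or_ne d 0 with h0 | h0
  · rw [h0] at hnn ⊢
    rw [abs_zero, mul_zero]
    exact intervalIntegral.integral_nonneg ht.le fun r hr ↦ hnn r hr.1
  have hd2 : 0 < d ^ 2 := by positivity
  have hs : 0 < κ * d ^ 2 := by positivity
  have hst : κ * d ^ 2 ≤ t := by
    rw [hκ, div_mul_eq_mul_div, div_le_iff₀ (by positivity), ← sq_abs d]
    gcongr
  have hint := intervalIntegrable_inv_sqrt_mul_one_sub_exp ht d
  have habs : 0 < |d| := abs_pos.2 h0
  calc κ * (1 / sqrt (π * κ) * (1 - exp (-(1 / (4 * κ))))) * |d|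
      = ∫ _r in (0 : ℝ)..(κ * d ^ 2),
          1 / sqrt (π * (κ * d ^ 2)) * (1 - exp (-(1 / (4 * κ)))) := by
        rw [intervalIntegral.integral_const, ← mul_assoc π, sqrt_mul (by positivity) (d ^ 2), sqrt_sq_eq_abs,
          smul_eq_mul, sub_zero, ← sq_abs d]
        field_simp
    _ ≤ ∫ r in (0 : ℝ)..(κ * d ^ 2), 1 / sqrt (π * r) * (1 - exp (-d ^ 2 / (4 * r))) := by
        refine intervalIntegral.integral_mono_on_of_le_Ioo hs.le intervalIntegrable_const
          (intervalIntegrable_inv_sqrt_mul_one_sub_exp hs d) fun r hr ↦ ?_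
        have hr0 : 0 < r := hr.1
        have hr1 : r ≤ κ * d ^ 2 := hr.2.le
        have hpr : 0 < sqrt (π * r) := sqrt_pos.2 (by positivity)
        have he : -d ^ 2 / (4 * r) ≤ -(1 / (4 * κ)) := by
          rw [neg_div, neg_le_neg_iff, div_le_div_iff₀ (by positivity) (by positivity)]
          linarith
        gcongr
    _ ≤ _ := by
        refine intervalIntegral.integral_mono_interval le_rfl hs.le hst ?_ hint
        filter_upwards [ae_restrict_mem measurableSet_Ioc] with r hr
        exact hnn r hr.1.le

lemma lintegral_ofReal_mul_abs_rpow_lt_top {C q : ℝ} (hC : 0 < C) (hq : -1 < q) (L : ℝ) :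
    ∫⁻ u in Set.Icc (-L) L, ENNReal.ofReal (C * |u|) ^ q < ⊤ := by
  rcases lt_or_ge L 0 with hL | hL
  · rw [Set.Icc_eq_empty (by linarith)]
    simp
  have hint : IntervalIntegrable (fun u : ℝ ↦ (C * |u|) ^ q) volume (-L) L := by
    refine intervalIntegrable_of_even (fun u ↦ by rw [abs_neg]) (fun x hx ↦ ?_) enorm_ne_top enorm_ne_top
    refine ((intervalIntegral.intervalIntegrable_rpow' hq).const_mul (C ^ q)).congr ?_
    intro u hu
    rw [Set.uIoc_of_le hx.le] at hu
    simp only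
    rw [abs_of_pos hu.1, mul_rpow hC.le hu.1.le]
  rw [intervalIntegrable_iff_integrableOn_Icc_of_le (by linarith)] at hint
  refine lt_of_eq_of_lt (lintegral_congr_ae ?_) hint.lintegral_lt_top
  filter_upwards [ae_restrict_of_ae (Measure.ae_ne volume (0 : ℝ))] with u hu
  exact ENNReal.ofReal_rpow_of_pos (mul_pos hC (abs_pos.2 hu))

theorem stmt_17 (t : ℝ) (ht : 0 < t) (a b : ℝ) (hab : a < b)
    (p : ℝ) (hp0 : 0 ≤ p) (hp1 : p < 1) :
    (∫⁻ x in Set.Icc a b, ∫⁻ y in Set.Icc a b,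
      (ENNReal.ofReal
          (∫ r in (0:ℝ)..t, ∫ z : ℝ,
            (G r (x - z) - G r (y - z)) ^ 2)) ^ (-(p + 1) / 2 : ℝ)) < ⊤ := by
  obtain ⟨C, hC, hle⟩ := exists_mul_abs_le_integral ht (sub_pos.2 hab)
  set K := ∫⁻ u in Set.Icc (-(b - a)) (b - a), ENNReal.ofReal (C * |u|) ^ (-(p + 1) / 2 : ℝ)
    with hK
  have hKtop : K < ⊤ := lintegral_ofReal_mul_abs_rpow_lt_top hC (by linarith) _
  have hbound : ∀ x ∈ Set.Icc a b, (∫⁻ y in Set.Icc a b,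
      (ENNReal.ofReal
          (∫ r in (0:ℝ)..t, ∫ z : ℝ,
            (G r (x - z) - G r (y - z)) ^ 2)) ^ (-(p + 1) / 2 : ℝ)) ≤ K := by
    intro x hx
    rw [hK, ← lintegral_indicator measurableSet_Icc, ← lintegral_indicator measurableSet_Icc,
      ← lintegral_sub_left_eq_self _ x]
    refine lintegral_mono fun u ↦ ?_
    by_cases hu : x - u ∈ Set.Icc a b
    · have hu' : u ∈ Set.Icc (-(b - a)) (b - a) :=
        ⟨by linarith [hx.1, hu.2], by linarith [hx.2, hu.1]⟩
      rw [Set.indicator_of_mem hu, Set.indicator_of_mem hu']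
      have hxu := hle x (x - u)
      rw [sub_sub_cancel] at hxu
      rw [neg_div, ENNReal.rpow_neg, ENNReal.rpow_neg, ENNReal.inv_le_inv]
      exact ENNReal.rpow_le_rpow (ENNReal.ofReal_le_ofReal (hxu (abs_le.2 hu'))) (by linarith)
    · rw [Set.indicator_of_notMem hu]
      exact zero_le
  calc _ ≤ ∫⁻ _x in Set.Icc a b, K := setLIntegral_mono measurable_const hbound
    _ < ⊤ := by
      rw [setLIntegral_const, Real.volume_Icc]
      exact ENNReal.mul_lt_top hKtop ENNReal.ofReal_lt_top
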